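/- Let F be a finite union-closed family of finite sets with ∅ ∈ F, let U be a finite set, and let D be a finite set with D ⊇ ⋃F and D ∖ U ≠ ∅. Then there exists an extension F' = F ∨ H of (F, U) such that: (i) H is a filter of 2^{D∖U}, (ii) F'_{∖U} = H, (iii) F' minimizes μ in D, and (iv) F'_{∖N²} = {D ∖ N²}, where N² = N_F(N_F(U)). -/

import Mathlib

open Finset

/-- `F` is union-closed. -/
def UnionClosed {α : Type*} [DecidableEq α] (F : Finset (Finset α)) : Prop :=
  ∀ A ∈ F, ∀ B ∈ F, A ∪ B ∈ F

/-- The generators `J(F)`: nonempty members of `F` that are not the union of the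
members of `F` properly contained in them. -/
def gens {α : Type*} [DecidableEq α] (F : Finset (Finset α)) : Finset (Finset α) :=
  F.filter (fun U => U.Nonempty ∧ (F.filter (fun A => A ⊂ U)).sup id ≠ U)

/-- The closure `π_F(X)`: the union of all members of `F` contained in `X`. -/
def piF {α : Type*} [DecidableEq α] (F : Finset (Finset α)) (X : Finset α) : Finset α :=
  (F.filter (fun A => A ⊆ X)).sup id

/-- `F ∨ H = {A ∪ B : A ∈ F, B ∈ H}`. -/
def famJoin {α : Type*} [DecidableEq α] (F H : Finset (Finset α)) : Finset (Finset α) :=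
  (F ×ˢ H).image (fun p => p.1 ∪ p.2)

/-- `F'` is an extension of `(F, U)`: `F' = F ∨ H` for some nonempty union-closed
family `H` with `(⋃ H) ∩ U = ∅`. -/
def IsExtension {α : Type*} [DecidableEq α] (F : Finset (Finset α)) (U : Finset α)
    (F' : Finset (Finset α)) : Prop :=
  ∃ H : Finset (Finset α), H.Nonempty ∧ UnionClosed H ∧ (H.sup id) ∩ U = ∅ ∧ F' = famJoin F H

/-- The restriction of `F` away from `U`: `F_{∖U} = {A ∖ U : A ∈ F}`. -/
def resAway {α : Type*} [DecidableEq α] (F : Finset (Finset α)) (U : Finset α) :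
    Finset (Finset α) :=
  F.image (fun A => A \ U)

/-- `E_{F,U}(X)`: the subsets `Y ⊆ U` with `π_F(X ∪ Y) ∩ U = Y` and
`π_F(X ∪ Y) ⊇ π_F(X ∪ U) \ U`. -/
def Efam {α : Type*} [DecidableEq α] (F : Finset (Finset α)) (U X : Finset α) :
    Finset (Finset α) :=
  U.powerset.filter (fun Y => piF F (X ∪ Y) ∩ U = Y ∧ piF F (X ∪ U) \ U ⊆ piF F (X ∪ Y))

/-- `μ_{F,F'}(U) = (Σ_{X ∈ F'_{∖U}} |E_{F,U}(X)|) / |F'_{∖U}|`. -/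
def mu {α : Type*} [DecidableEq α] (F : Finset (Finset α)) (U : Finset α)
    (F' : Finset (Finset α)) : ℚ :=
  (∑ X ∈ resAway F' U, ((Efam F U X).card : ℚ)) / ((resAway F' U).card : ℚ)

/-- The union-closed family generated by `G` (all unions of subfamilies of `G`;
it contains `∅` as the empty union). -/
def genUC {α : Type*} [DecidableEq α] (G : Finset (Finset α)) : Finset (Finset α) :=
  G.powerset.image (fun S => S.sup id)

/-- The lattice neighborhood `𝒩_F(U)`: the union-closed family generated by `{∅}`
together with the generators of `F` meeting `U`. -/
def latNbhd {α : Type*} [DecidableEq α] (F : Finset (Finset α)) (U : Finset α) :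
    Finset (Finset α) :=
  genUC ((gens F).filter (fun V => (V ∩ U).Nonempty))

/-- The third lattice neighborhood `𝒩³_F(U) = 𝒩_F(⋃ 𝒩_F(U))`. -/
def latNbhd3 {α : Type*} [DecidableEq α] (F : Finset (Finset α)) (U : Finset α) :
    Finset (Finset α) :=
  latNbhd F ((latNbhd F U).sup id)

/-- The neighborhood `N_F(X) = X ∪ ⋃ {V ∈ J(F) : V ∩ X ≠ ∅}`. -/
def nbhd {α : Type*} [DecidableEq α] (F : Finset (Finset α)) (X : Finset α) : Finset α :=
  X ∪ ((gens F).filter (fun V => (V ∩ X).Nonempty)).sup id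

/-- `H` is a filter of `2^S`: a nonempty family of subsets of `S` closed upward in `S`. -/
def IsFilterOn {α : Type*} [DecidableEq α] (S : Finset α) (H : Finset (Finset α)) : Prop :=
  H.Nonempty ∧ (∀ X ∈ H, X ⊆ S) ∧ ∀ X ∈ H, ∀ Y, X ⊆ Y → Y ⊆ S → Y ∈ H

/-- `F'` minimizes `μ` in `D` (among extensions of `(F, U)` with union inside `D`). -/
def MinimizesMu {α : Type*} [DecidableEq α] (F : Finset (Finset α)) (U D : Finset α)
    (F' : Finset (Finset α)) : Prop :=
  F'.sup id ⊆ D ∧ ∀ F'', IsExtension F U F'' → F''.sup id ⊆ D → mu F U F' ≤ mu F U F''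

/-- The degree of `U` in the graph `G`: the number of members of `G` other than `U`
meeting `U`. -/
def degG {α : Type*} [DecidableEq α] (G : Finset (Finset α)) (U : Finset α) : ℕ :=
  (G.filter (fun V => V ≠ U ∧ (V ∩ U).Nonempty)).card

section LocalStructure

variable {α : Type*} [DecidableEq α]

lemma mem_piF {F : Finset (Finset α)} {X : Finset α} {x : α} :
    x ∈ piF F X ↔ ∃ A ∈ F, A ⊆ X ∧ x ∈ A := by
  simp [piF, Finset.mem_sup, and_assoc]

lemma piF_subset (F : Finset (Finset α)) (X : Finset α) : piF F X ⊆ X := by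
  intro x hx
  obtain ⟨A, -, hAX, hxA⟩ := mem_piF.1 hx
  exact hAX hxA

lemma UnionClosed.piF_mem {F : Finset (Finset α)} (hUC : UnionClosed F) (hempty : ∅ ∈ F)
    (X : Finset α) : piF F X ∈ F := by
  unfold piF
  refine Finset.sup_induction (p := fun A => A ∈ F) hempty (fun A hA B hB => hUC A hA B hB) ?_
  intro A hA
  exact (Finset.mem_filter.1 hA).1

lemma exists_gens_of_mem {F : Finset (Finset α)} {x : α} (A : Finset α) (hA : A ∈ F)
    (hx : x ∈ A) : ∃ V ∈ gens F, V ⊆ A ∧ x ∈ V := by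
  induction A using Finset.strongInduction with
  | H A ih =>
    by_cases hg : A ∈ gens F
    · exact ⟨A, hg, subset_rfl, hx⟩
    · have hs : (F.filter (fun B => B ⊂ A)).sup id = A := by
        by_contra hne
        exact hg (Finset.mem_filter.2 ⟨hA, ⟨x, hx⟩, hne⟩)
      rw [← hs] at hx
      obtain ⟨B, hB, hxB⟩ := Finset.mem_sup.1 hx
      obtain ⟨hBF, hBA⟩ := Finset.mem_filter.1 hB
      obtain ⟨V, hV, hVB, hxV⟩ := ih B hBA hBF hxB
      exact ⟨V, hV, hVB.trans hBA.subset, hxV⟩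

lemma mem_piF_iff_gens {F : Finset (Finset α)} {X : Finset α} {x : α} :
    x ∈ piF F X ↔ ∃ V ∈ gens F, V ⊆ X ∧ x ∈ V := by
  rw [mem_piF]
  constructor
  · rintro ⟨A, hA, hAX, hx⟩
    obtain ⟨V, hV, hVA, hxV⟩ := exists_gens_of_mem A hA hx
    exact ⟨V, hV, hVA.trans hAX, hxV⟩
  · rintro ⟨V, hV, h⟩
    exact ⟨V, (Finset.mem_filter.1 hV).1, h⟩

lemma subset_nbhd (F : Finset (Finset α)) (X : Finset α) : X ⊆ nbhd F X :=
  Finset.subset_union_left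

lemma gens_subset_nbhd {F : Finset (Finset α)} {X V : Finset α} {x : α} (hV : V ∈ gens F)
    (hxV : x ∈ V) (hxX : x ∈ X) : V ⊆ nbhd F X := by
  refine subset_trans ?_ Finset.subset_union_right
  exact Finset.le_sup (f := id)
    (Finset.mem_filter.2 ⟨hV, x, Finset.mem_inter.2 ⟨hxV, hxX⟩⟩)

lemma mem_piF_union_of_inter_eq {F : Finset (Finset α)} {N X X' Y : Finset α} {x : α}
    (h : X ∩ nbhd F N = X' ∩ nbhd F N) (hxN : x ∈ N) (hx : x ∈ piF F (X ∪ Y)) :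
    x ∈ piF F (X' ∪ Y) := by
  obtain ⟨V, hV, hVX, hxV⟩ := mem_piF_iff_gens.1 hx
  refine mem_piF_iff_gens.2 ⟨V, hV, fun v hv => ?_, hxV⟩
  have hvN := gens_subset_nbhd hV hxV hxN hv
  rcases Finset.mem_union.1 (hVX hv) with hvX | hvY
  · have : v ∈ X' ∩ nbhd F N := h ▸ Finset.mem_inter.2 ⟨hvX, hvN⟩
    exact Finset.mem_union_left _ (Finset.mem_inter.1 this).1
  · exact Finset.mem_union_right _ hvY

lemma Efam_subset_of_inter_eq {F : Finset (Finset α)} {U X X' : Finset α}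
    (h : X ∩ nbhd F (nbhd F U) = X' ∩ nbhd F (nbhd F U)) : Efam F U X ⊆ Efam F U X' := by
  intro Y hY
  obtain ⟨hYU, htrace, hcover⟩ := Finset.mem_filter.1 hY
  refine Finset.mem_filter.2 ⟨hYU, ?_, ?_⟩
  · refine Eq.trans ?_ htrace
    ext x
    simp only [Finset.mem_inter]
    constructor
    · rintro ⟨hx, hxU⟩
      exact ⟨mem_piF_union_of_inter_eq h.symm (subset_nbhd F U hxU) hx, hxU⟩
    · rintro ⟨hx, hxU⟩
      exact ⟨mem_piF_union_of_inter_eq h (subset_nbhd F U hxU) hx, hxU⟩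
  · intro x hx
    obtain ⟨hx, hxU⟩ := Finset.mem_sdiff.1 hx
    by_cases hxN : x ∈ nbhd F U
    · have hx' := mem_piF_union_of_inter_eq h.symm hxN hx
      exact mem_piF_union_of_inter_eq h hxN (hcover (Finset.mem_sdiff.2 ⟨hx', hxU⟩))
    · obtain ⟨V, hV, hVX, hxV⟩ := mem_piF_iff_gens.1 hx
      refine mem_piF_iff_gens.2 ⟨V, hV, fun v hv => ?_, hxV⟩
      rcases Finset.mem_union.1 (hVX hv) with hvX | hvU
      · exact Finset.mem_union_left _ hvX
      · exact absurd (gens_subset_nbhd hV hv hvU hxV) hxN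

lemma Efam_eq_of_inter_eq {F : Finset (Finset α)} {U X X' : Finset α}
    (h : X ∩ nbhd F (nbhd F U) = X' ∩ nbhd F (nbhd F U)) : Efam F U X = Efam F U X' :=
  (Efam_subset_of_inter_eq h).antisymm (Efam_subset_of_inter_eq h.symm)

lemma Efam_eq_of_piF_eq {F : Finset (Finset α)} {U X X' : Finset α}
    (h : ∀ Y ⊆ U, piF F (X ∪ Y) = piF F (X' ∪ Y)) : Efam F U X = Efam F U X' := by
  unfold Efam
  refine Finset.filter_congr fun Y hY => ?_
  rw [h Y (Finset.mem_powerset.1 hY), h U subset_rfl]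

end LocalStructure

section UpCompression

variable {α : Type*} [DecidableEq α]

/-- The up-compression of a member `X` of `G` in direction `i`. -/
def upSet (G : Finset (Finset α)) (i : α) (X : Finset α) : Finset α :=
  if insert i X ∈ G then X else insert i X

lemma subset_upSet (G : Finset (Finset α)) (i : α) (X : Finset α) : X ⊆ upSet G i X := by
  unfold upSet
  split_ifs
  · exact subset_rfl
  · exact Finset.subset_insert i X

lemma upSet_injOn (G : Finset (Finset α)) (i : α) : Set.InjOn (upSet G i) G := by
  intro X hX Y hY h
  have hX : X ∈ G := hX
  have hY : Y ∈ G := hY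
  unfold upSet at h
  split_ifs at h with h₁ h₂ h₂
  · exact h
  · exact absurd (h ▸ hX) h₂
  · exact absurd (h ▸ hY) h₁
  · have hiX : i ∉ X := fun hi => h₁ (by rwa [Finset.insert_eq_of_mem hi])
    have hiY : i ∉ Y := fun hi => h₂ (by rwa [Finset.insert_eq_of_mem hi])
    rw [← Finset.erase_insert hiX, h, Finset.erase_insert hiY]

lemma mem_image_upSet {G : Finset (Finset α)} {i : α} {Z : Finset α} :
    Z ∈ G.image (upSet G i) ↔
      (Z ∈ G ∧ insert i Z ∈ G) ∨ ∃ X ∈ G, insert i X ∉ G ∧ insert i X = Z := by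
  simp only [Finset.mem_image, upSet]
  constructor
  · rintro ⟨X, hX, h⟩
    split_ifs at h with h₁
    · subst h
      exact Or.inl ⟨hX, h₁⟩
    · exact Or.inr ⟨X, hX, h₁, h⟩
  · rintro (⟨hZ, h⟩ | ⟨X, hX, h, rfl⟩)
    · exact ⟨Z, hZ, if_pos h⟩
    · exact ⟨X, hX, if_neg h⟩

lemma insert_mem_image_upSet {G : Finset (Finset α)} {i : α} {X : Finset α} (hX : X ∈ G) :
    insert i X ∈ G.image (upSet G i) := by
  by_cases h : insert i X ∈ G
  · exact mem_image_upSet.2 (Or.inl ⟨h, by rwa [Finset.insert_idem]⟩)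
  · exact mem_image_upSet.2 (Or.inr ⟨X, hX, h, rfl⟩)

lemma UnionClosed.image_upSet {G : Finset (Finset α)} (hG : UnionClosed G) (i : α) :
    UnionClosed (G.image (upSet G i)) := by
  intro A hA B hB
  rcases mem_image_upSet.1 hA with ⟨hA, hiA⟩ | ⟨X, hX, -, rfl⟩
  · rcases mem_image_upSet.1 hB with ⟨hB, hiB⟩ | ⟨Y, hY, -, rfl⟩
    · refine mem_image_upSet.2 (Or.inl ⟨hG A hA B hB, ?_⟩)
      rw [← Finset.insert_union]
      exact hG _ hiA _ hB
    · rw [Finset.union_insert]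
      exact insert_mem_image_upSet (hG A hA Y hY)
  · rcases mem_image_upSet.1 hB with ⟨hB, -⟩ | ⟨Y, hY, -, rfl⟩
    · rw [Finset.insert_union]
      exact insert_mem_image_upSet (hG X hX B hB)
    · rw [Finset.insert_union, Finset.union_insert, Finset.insert_idem]
      exact insert_mem_image_upSet (hG X hX Y hY)

/-- Adding single elements suffices to generate a filter. -/
lemma isFilterOn_of_insert {S : Finset α} {G : Finset (Finset α)} (hne : G.Nonempty)
    (hS : ∀ X ∈ G, X ⊆ S) (hins : ∀ X ∈ G, ∀ i ∈ S, insert i X ∈ G) : IsFilterOn S G := by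
  refine ⟨hne, hS, fun X hX Y hXY hYS => ?_⟩
  have key : ∀ T ⊆ S, X ∪ T ∈ G := by
    intro T
    induction T using Finset.induction_on with
    | empty => intro _; simpa using hX
    | insert a T _ ih =>
      intro hT
      rw [Finset.union_insert]
      exact hins _ (ih ((Finset.subset_insert a T).trans hT)) a (hT (Finset.mem_insert_self a T))
  have := key Y hYS
  rwa [Finset.union_eq_right.2 hXY] at this

/-- Reimer's up-compression: a union-closed family is in bijection with a filter, each member
being sent to a superset so that no other member lies in between. -/
lemma exists_filter_bijection (S : Finset α) (G : Finset (Finset α)) (hne : G.Nonempty)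
    (hG : UnionClosed G) (hS : ∀ X ∈ G, X ⊆ S) :
    ∃ φ : Finset α → Finset α, Set.InjOn φ G ∧ IsFilterOn S (G.image φ) ∧
      (∀ X ∈ G, X ⊆ φ X) ∧ ∀ X ∈ G, ∀ X' ∈ G, X ⊆ X' → X' ⊆ φ X → X = X' := by
  induction hn : ∑ X ∈ G, (S \ X).card using Nat.strong_induction_on generalizing G with
  | _ n ih =>
    by_cases hins : ∀ X ∈ G, ∀ i ∈ S, insert i X ∈ G
    · refine ⟨id, Function.injective_id.injOn, ?_, fun X _ => subset_rfl,
        fun X _ X' _ h h' => h.antisymm h'⟩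
      rw [Finset.image_id]
      exact isFilterOn_of_insert hne hS hins
    push Not at hins
    obtain ⟨X₀, hX₀, i, hi, hiX₀⟩ := hins
    have hS' : ∀ X ∈ G.image (upSet G i), X ⊆ S := by
      intro Z hZ
      rcases mem_image_upSet.1 hZ with ⟨hZ, -⟩ | ⟨X, hX, -, rfl⟩
      · exact hS Z hZ
      · exact Finset.insert_subset hi (hS X hX)
    have hlt : ∑ X ∈ G.image (upSet G i), (S \ X).card < n := by
      rw [← hn, Finset.sum_image (upSet_injOn G i)]
      refine Finset.sum_lt_sum (fun X _ =>
        Finset.card_le_card (Finset.sdiff_subset_sdiff subset_rfl (subset_upSet G i X)))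
        ⟨X₀, hX₀, Finset.card_lt_card ?_⟩
      have hi₀ : i ∉ X₀ := fun h => hiX₀ (by rwa [Finset.insert_eq_of_mem h])
      refine (Finset.ssubset_iff_of_subset
        (Finset.sdiff_subset_sdiff subset_rfl (subset_upSet G i X₀))).2
        ⟨i, Finset.mem_sdiff.2 ⟨hi, hi₀⟩, ?_⟩
      simp [upSet, hiX₀]
    obtain ⟨φ, hinj, hfil, hsub, hsep⟩ :=
      ih _ hlt (G.image (upSet G i)) (hne.image _) (hG.image_upSet i) hS' rfl
    have hmem : ∀ X ∈ G, upSet G i X ∈ G.image (upSet G i) :=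
      fun X hX => Finset.mem_image_of_mem _ hX
    refine ⟨φ ∘ upSet G i, ?_, ?_, ?_, ?_⟩
    · refine hinj.comp (upSet_injOn G i) fun X hX => ?_
      exact_mod_cast hmem X hX
    · rwa [← Finset.image_image]
    · exact fun X hX => (subset_upSet G i X).trans (hsub _ (hmem X hX))
    · intro X hX X' hX' hXX' hX'φ
      have hX'φ : X' ⊆ φ (upSet G i X) := hX'φ
      by_cases hiX : insert i X ∈ G
      · have hup : upSet G i X = X := if_pos hiX
        have hup' : upSet G i X' = X' := by
          refine if_pos ?_
          have := hG _ hiX _ hX'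
          rwa [Finset.insert_union, Finset.union_eq_right.2 hXX'] at this
        rw [hup] at hX'φ
        exact hsep X (hup ▸ hmem X hX) X' (hup' ▸ hmem X' hX') hXX' hX'φ
      · have hup : upSet G i X = insert i X := if_neg hiX
        have hin : insert i X ∈ G.image (upSet G i) := hup ▸ hmem X hX
        rw [hup] at hX'φ
        have heq : insert i X = insert i X' :=
          hsep _ hin _ (insert_mem_image_upSet hX') (Finset.insert_subset_insert i hXX')
            (Finset.insert_subset (hsub _ hin (Finset.mem_insert_self i X)) hX'φ)
        refine upSet_injOn G i hX hX' ?_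
        rw [hup, upSet, if_neg (heq ▸ hiX), heq]

end UpCompression

section Minimization

variable {α : Type*} [DecidableEq α]

lemma mem_resAway_famJoin {F H : Finset (Finset α)} {U Z : Finset α} :
    Z ∈ resAway (famJoin F H) U ↔ ∃ A ∈ F, ∃ B ∈ H, (A ∪ B) \ U = Z := by
  simp only [resAway, famJoin, Finset.mem_image, Finset.mem_product, Prod.exists]
  constructor
  · rintro ⟨_, ⟨A, B, ⟨hA, hB⟩, rfl⟩, h⟩
    exact ⟨A, hA, B, hB, h⟩
  · rintro ⟨A, hA, B, hB, h⟩
    exact ⟨_, ⟨A, B, ⟨hA, hB⟩, rfl⟩, h⟩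

lemma IsFilterOn.unionClosed {S : Finset α} {H : Finset (Finset α)} (hH : IsFilterOn S H) :
    UnionClosed H := fun A hA B hB =>
  hH.2.2 A hA _ Finset.subset_union_left (Finset.union_subset (hH.2.1 A hA) (hH.2.1 B hB))

lemma IsFilterOn.isExtension {F H : Finset (Finset α)} {U D : Finset α}
    (hH : IsFilterOn (D \ U) H) : IsExtension F U (famJoin F H) := by
  refine ⟨H, hH.1, hH.unionClosed, ?_, rfl⟩
  rw [← Finset.disjoint_iff_inter_eq_empty]
  exact Finset.disjoint_of_subset_left (Finset.sup_le (f := id) hH.2.1) Finset.sdiff_disjoint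

lemma subset_of_sup_subset {F : Finset (Finset α)} {A D : Finset α} (h : F.sup id ⊆ D)
    (hA : A ∈ F) : A ⊆ D :=
  (Finset.le_sup (f := id) hA).trans h

lemma IsFilterOn.resAway_famJoin {F H : Finset (Finset α)} {U D : Finset α}
    (hH : IsFilterOn (D \ U) H) (hempty : ∅ ∈ F) (hD : F.sup id ⊆ D) :
    resAway (famJoin F H) U = H := by
  have hsd : ∀ B ∈ H, B \ U = B := fun B hB => Finset.sdiff_eq_self_of_disjoint
    (Finset.disjoint_of_subset_left (hH.2.1 B hB) Finset.sdiff_disjoint)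
  ext Z
  rw [mem_resAway_famJoin]
  constructor
  · rintro ⟨A, hA, B, hB, rfl⟩
    refine hH.2.2 B hB _ ?_ (Finset.sdiff_subset_sdiff ?_ subset_rfl)
    · rw [Finset.union_sdiff_distrib, hsd B hB]
      exact Finset.subset_union_right
    · exact Finset.union_subset (subset_of_sup_subset hD hA)
        ((hH.2.1 B hB).trans Finset.sdiff_subset)
  · intro hZ
    exact ⟨∅, hempty, Z, hZ, by rw [Finset.empty_union, hsd Z hZ]⟩

lemma IsFilterOn.sup_famJoin_subset {F H : Finset (Finset α)} {U D : Finset α}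
    (hH : IsFilterOn (D \ U) H) (hD : F.sup id ⊆ D) : (famJoin F H).sup id ⊆ D := by
  refine Finset.sup_le fun Z hZ => ?_
  obtain ⟨⟨A, B⟩, hAB, rfl⟩ := Finset.mem_image.1 hZ
  obtain ⟨hA, hB⟩ := Finset.mem_product.1 hAB
  exact Finset.union_subset (subset_of_sup_subset hD hA)
    ((hH.2.1 B hB).trans Finset.sdiff_subset)

/-- A union-closed family absorbing `F` away from `U` has the same size and the same sum of
`|E_{F,U}|` as some filter. -/
lemma exists_filter_sum_eq {F G : Finset (Finset α)} {U S : Finset α}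
    (hUC : UnionClosed F) (hempty : ∅ ∈ F) (hne : G.Nonempty) (hG : UnionClosed G)
    (hS : ∀ X ∈ G, X ⊆ S) (hSU : Disjoint S U) (hGF : ∀ X ∈ G, ∀ A ∈ F, X ∪ A \ U ∈ G) :
    ∃ H, IsFilterOn S H ∧ H.card = G.card ∧
      ∑ X ∈ H, ((Efam F U X).card : ℚ) = ∑ X ∈ G, ((Efam F U X).card : ℚ) := by
  obtain ⟨φ, hinj, hfil, hsub, hsep⟩ := exists_filter_bijection S G hne hG hS
  refine ⟨G.image φ, hfil, Finset.card_image_of_injOn hinj, ?_⟩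
  rw [Finset.sum_image hinj]
  refine Finset.sum_congr rfl fun X hX => ?_
  rw [Efam_eq_of_piF_eq (X := φ X) (X' := X)]
  intro Y hY
  ext x
  constructor
  · intro hx
    have hA : piF F (φ X ∪ Y) ∈ F := hUC.piF_mem hempty _
    have hAφ : piF F (φ X ∪ Y) \ U ⊆ φ X := by
      intro a ha
      obtain ⟨ha, haU⟩ := Finset.mem_sdiff.1 ha
      exact (Finset.mem_union.1 (piF_subset _ _ ha)).resolve_right fun h => haU (hY h)
    have hXA : X = X ∪ piF F (φ X ∪ Y) \ U :=
      hsep X hX _ (hGF X hX _ hA) Finset.subset_union_left (Finset.union_subset (hsub X hX) hAφ)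
    refine mem_piF.2 ⟨_, hA, fun a ha => ?_, hx⟩
    by_cases haU : a ∈ U
    · rcases Finset.mem_union.1 (piF_subset _ _ ha) with haφ | haY
      · exact absurd haU (Finset.disjoint_left.1 hSU
          (hfil.2.1 _ (Finset.mem_image_of_mem φ hX) haφ))
      · exact Finset.mem_union_right _ haY
    · refine Finset.mem_union_left _ ?_
      rw [hXA]
      exact Finset.mem_union_right _ (Finset.mem_sdiff.2 ⟨ha, haU⟩)
  · intro hx
    obtain ⟨A, hA, hAX, hxA⟩ := mem_piF.1 hx
    exact mem_piF.2 ⟨A, hA, hAX.trans (Finset.union_subset_union (hsub X hX) subset_rfl), hxA⟩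

/-- If `f X` depends only on `X ∩ N`, an upper bound for the average of `f` over a filter is also
one for some filter whose members all contain `S \ N`. -/
lemma exists_filter_sum_le {H : Finset (Finset α)} {S N : Finset α} (f : Finset α → ℚ) (c : ℚ)
    (hH : IsFilterOn S H) (hf : ∀ X X', X ∩ N = X' ∩ N → f X = f X')
    (hc : ∑ X ∈ H, f X ≤ H.card * c) :
    ∃ H', IsFilterOn S H' ∧ (∀ X ∈ H', S \ N ⊆ X) ∧ ∑ X ∈ H', f X ≤ H'.card * c := by
  have hsum : ∑ T ∈ H.image (· \ N), ∑ X ∈ H with X \ N = T, (f X - c) ≤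
      ∑ T ∈ H.image (· \ N), (0 : ℚ) := by
    rw [Finset.sum_fiberwise_of_maps_to (fun X hX => Finset.mem_image_of_mem _ hX)]
    simp only [Finset.sum_sub_distrib, Finset.sum_const, nsmul_eq_mul, mul_zero]
    linarith
  obtain ⟨T, hT, hle⟩ := Finset.exists_le_of_sum_le (hH.1.image _) hsum
  obtain ⟨X₀, hX₀, rfl⟩ := Finset.mem_image.1 hT
  have hinj : Set.InjOn (· ∪ S \ N) ((H.filter (fun X => X \ N = X₀ \ N) : Finset _) : Set _) := by
    intro X hX Y hY h
    have hX := (Finset.mem_filter.1 hX).2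
    have hY := (Finset.mem_filter.1 hY).2
    ext x
    by_cases hx : x ∈ N
    · have := Finset.ext_iff.1 h x
      simpa [hx] using this
    · have := Finset.ext_iff.1 (hX.trans hY.symm) x
      simpa [hx] using this
  refine ⟨(H.filter (fun X => X \ N = X₀ \ N)).image (· ∪ S \ N), ⟨?_, ?_, ?_⟩, ?_, ?_⟩
  · exact ⟨_, Finset.mem_image_of_mem _ (Finset.mem_filter.2 ⟨hX₀, rfl⟩)⟩
  · intro Z hZ
    obtain ⟨X, hX, rfl⟩ := Finset.mem_image.1 hZ
    exact Finset.union_subset (hH.2.1 X (Finset.mem_filter.1 hX).1) Finset.sdiff_subset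
  · intro Z hZ Y hZY hYS
    obtain ⟨X, hX, rfl⟩ := Finset.mem_image.1 hZ
    obtain ⟨hX, hXN⟩ := Finset.mem_filter.1 hX
    have hXS := hH.2.1 X hX
    have hX₀S := hH.2.1 X₀ hX₀
    have hXY := Finset.union_subset_left hZY
    have hSY := Finset.union_subset_right hZY
    refine Finset.mem_image.2 ⟨Y ∩ N ∪ X \ N, Finset.mem_filter.2 ⟨?_, ?_⟩, ?_⟩
    · refine hH.2.2 X hX _ ?_ ?_ <;> intro x <;> grind
    · rw [← hXN]
      grind
    · grind
  · intro Z hZ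
    obtain ⟨X, -, rfl⟩ := Finset.mem_image.1 hZ
    exact Finset.subset_union_right
  · rw [Finset.sum_image hinj, Finset.card_image_of_injOn hinj]
    have hf' : ∀ X, f (X ∪ S \ N) = f X := fun X => hf _ _ (by grind)
    simp only [hf']
    simp only [Finset.sum_sub_distrib, Finset.sum_const, nsmul_eq_mul] at hle
    linarith

end Minimization

/-- Theorem 3.17: for `D ⊇ ⋃ F` (with `D ∖ U ≠ ∅`) there is an extension
`F' = F ∨ H` of `(F, U)` such that (i) `H` is a filter of `2^{D∖U}`,
(ii) `F'_{∖U} = H`, (iii) `F'` minimizes `μ` in `D`, and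
(iv) `F'_{∖N²} = {D ∖ N²}` where `N² = N_F(N_F(U))`. -/
theorem stmt13 {α : Type*} [DecidableEq α] (F : Finset (Finset α))
    (hUC : UnionClosed F) (hempty : ∅ ∈ F) (U D : Finset α)
    (hD : F.sup id ⊆ D) (hDU : (D \ U).Nonempty) :
    ∃ H : Finset (Finset α),
      IsExtension F U (famJoin F H) ∧
      IsFilterOn (D \ U) H ∧
      resAway (famJoin F H) U = H ∧
      MinimizesMu F U D (famJoin F H) ∧
      resAway (famJoin F H) (nbhd F (nbhd F U)) = {D \ nbhd F (nbhd F U)} := by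
  classical
  have hUN : U ⊆ nbhd F (nbhd F U) := (subset_nbhd F U).trans (subset_nbhd F _)
  set N := nbhd F (nbhd F U) with hN
  let avg : Finset (Finset α) → ℚ := fun H => (∑ X ∈ H, ((Efam F U X).card : ℚ)) / H.card
  let C := (D \ U).powerset.powerset.filter
    (fun H => IsFilterOn (D \ U) H ∧ ∀ X ∈ H, (D \ U) \ N ⊆ X)
  have hmemC : ∀ H, H ∈ C ↔ IsFilterOn (D \ U) H ∧ ∀ X ∈ H, (D \ U) \ N ⊆ X := by
    intro H
    refine ⟨fun h => (Finset.mem_filter.1 h).2, fun h => Finset.mem_filter.2 ⟨?_, h⟩⟩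
    exact Finset.mem_powerset.2 fun X hX => Finset.mem_powerset.2 (h.1.2.1 X hX)
  have hC : C.Nonempty := by
    refine ⟨{D \ U}, (hmemC _).2 ⟨⟨by simp, by simp, ?_⟩, fun X hX => ?_⟩⟩
    · intro X hX Y hXY hYD
      rw [Finset.mem_singleton] at hX ⊢
      subst hX
      exact hYD.antisymm hXY
    · rw [Finset.mem_singleton.1 hX]
      exact Finset.sdiff_subset
  obtain ⟨H, hHC, hmin⟩ := Finset.exists_min_image C avg hC
  obtain ⟨hH, hHN⟩ := (hmemC H).1 hHC
  have hres := hH.resAway_famJoin hempty hD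
  refine ⟨H, hH.isExtension, hH, hres, ⟨hH.sup_famJoin_subset hD, ?_⟩, ?_⟩
  · rintro F'' ⟨K, hKne, hK, hKU, rfl⟩ hKD
    have hsupD : ∀ A ∈ F, ∀ B ∈ K, A ∪ B ⊆ D := fun A hA B hB =>
      subset_of_sup_subset hKD (Finset.mem_image.2 ⟨(A, B), Finset.mem_product.2 ⟨hA, hB⟩, rfl⟩)
    have hGne : (resAway (famJoin F K) U).Nonempty := by
      obtain ⟨B, hB⟩ := hKne
      exact ⟨_, mem_resAway_famJoin.2 ⟨∅, hempty, B, hB, rfl⟩⟩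
    obtain ⟨H₁, hH₁, hcard, hsum⟩ := exists_filter_sum_eq (U := U) (S := D \ U)
      (G := resAway (famJoin F K) U) hUC hempty hGne
      (by
        intro Z hZ W hW
        obtain ⟨A, hA, B, hB, rfl⟩ := mem_resAway_famJoin.1 hZ
        obtain ⟨A', hA', B', hB', rfl⟩ := mem_resAway_famJoin.1 hW
        exact mem_resAway_famJoin.2 ⟨A ∪ A', hUC A hA A' hA', B ∪ B', hK B hB B' hB', by grind⟩)
      (by
        intro Z hZ
        obtain ⟨A, hA, B, hB, rfl⟩ := mem_resAway_famJoin.1 hZ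
        exact Finset.sdiff_subset_sdiff (hsupD A hA B hB) subset_rfl)
      Finset.sdiff_disjoint
      (by
        intro Z hZ A' hA'
        obtain ⟨A, hA, B, hB, rfl⟩ := mem_resAway_famJoin.1 hZ
        exact mem_resAway_famJoin.2 ⟨A ∪ A', hUC A hA A' hA', B, hB, by grind⟩)
    have hpos : ∀ {G : Finset (Finset α)}, G.Nonempty → (0 : ℚ) < G.card := fun h => by
      exact_mod_cast h.card_pos
    have hc : ∑ X ∈ H₁, ((Efam F U X).card : ℚ) ≤ H₁.card * mu F U (famJoin F K) := by
      rw [hsum, hcard, mu, mul_div_cancel₀ _ (hpos hGne).ne']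
    obtain ⟨H₂, hH₂, hH₂N, hle⟩ := exists_filter_sum_le (N := N)
      (fun X => ((Efam F U X).card : ℚ)) _ hH₁
      (fun X X' h => by rw [Efam_eq_of_inter_eq h]) hc
    calc mu F U (famJoin F H) = avg H := by simp only [mu, hres, avg]
      _ ≤ avg H₂ := hmin H₂ ((hmemC H₂).2 ⟨hH₂, hH₂N⟩)
      _ ≤ mu F U (famJoin F K) := by
        rw [div_le_iff₀ (hpos hH₂.1), mul_comm]
        exact hle
  · have key : ∀ A ∈ F, ∀ B ∈ H, (A ∪ B) \ N = D \ N := by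
      intro A hA B hB
      have hAD := subset_of_sup_subset hD hA
      have hBD := hH.2.1 B hB
      have hNB := hHN B hB
      grind
    ext Z
    rw [mem_resAway_famJoin, Finset.mem_singleton]
    constructor
    · rintro ⟨A, hA, B, hB, rfl⟩
      exact key A hA B hB
    · rintro rfl
      obtain ⟨B, hB⟩ := hH.1
      exact ⟨∅, hempty, B, hB, key ∅ hempty B hB⟩
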